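/- Let ν > 0, ε ≥ 0, and let μ be the complex square root of ν² − iε with Re μ > 0. Let N > 0 and let χ : ℝ → ℝ be smooth with χ(t) = 0 for t ≤ N and χ(t) = 1 for t ≥ 2N. Let f : ℝ × [0,∞) → ℂ be continuous with compact support, and let u : ℝ × [0,∞) → ℂ be twice continuously differentiable with: (i) Δu − iεu = f in {x₂ > 0}; (ii) −∂_{x₂}u(x₁,0) = ν u(x₁,0) for every x₁; (iii) u(x) = b₁ χ(x₁) e^{−iμx₁ − νx₂} + b₂ χ(−x₁) e^{iμx₁ − νx₂} + ũ(x), where b₁, b₂ ∈ ℂ and |ũ(x)| + |∇ũ(x)| ≤ C e^{−a(1+x₁²)^{1/2}} for all x and some constants C > 0 and a > ε/(2ν). Then b₁ = iν μ^{−1} ∫_{ℝ²₊} f(x) e^{iμx₁ − νx₂} dx and b₂ = iν μ^{−1} ∫_{ℝ²₊} f(x) e^{−iμx₁ − νx₂} dx. -/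

import Mathlib

open Set MeasureTheory

/-- First partial derivative of a function on the closed half-plane `ℝ × [0,∞)`. -/
noncomputable def pd1 (f : ℝ × ℝ → ℂ) (q : ℝ × ℝ) : ℂ :=
  deriv (fun s : ℝ => f (s, q.2)) q.1

/-- Second partial derivative (one-sided at the boundary) of a function on `ℝ × [0,∞)`. -/
noncomputable def pd2 (f : ℝ × ℝ → ℂ) (q : ℝ × ℝ) : ℂ :=
  derivWithin (fun t : ℝ => f (q.1, t)) (Ici (0 : ℝ)) q.2

/-- The open upper half-plane `ℝ²₊ = {x₂ > 0}`. -/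
def upperHalf : Set (ℝ × ℝ) := {p : ℝ × ℝ | 0 < p.2}

/-- The wave `e^{iκx₁ − νx₂}`. -/
noncomputable def surfaceWave (κ : ℂ) (ν : ℝ) (p : ℝ × ℝ) : ℂ :=
  Complex.exp (Complex.I * κ * p.1 - ν * p.2)

/-- The closed half-plane `{x₂ ≥ 0}`. -/
def closedUpperHalf : Set (ℝ × ℝ) := {p : ℝ × ℝ | 0 ≤ p.2}

theorem closedUpperHalf_eq_prod : closedUpperHalf = univ ×ˢ Ici (0 : ℝ) := by
  ext p; simp [closedUpperHalf]

theorem uniqueDiffOn_closedUpperHalf : UniqueDiffOn ℝ closedUpperHalf := by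
  rw [closedUpperHalf_eq_prod]
  exact uniqueDiffOn_univ.prod (uniqueDiffOn_Ici 0)

theorem closedUpperHalf_mem_nhds {p : ℝ × ℝ} (hp : 0 < p.2) : closedUpperHalf ∈ nhds p :=
  Filter.mem_of_superset ((isOpen_lt continuous_const continuous_snd).mem_nhds hp)
    fun q (hq : 0 < q.2) => hq.le

theorem hasDerivAt_fst_of_differentiableOn {g : ℝ × ℝ → ℂ}
    (hg : DifferentiableOn ℝ g closedUpperHalf) {p : ℝ × ℝ} (hp : p ∈ closedUpperHalf) :
    HasDerivAt (fun s : ℝ => g (s, p.2)) (fderivWithin ℝ g closedUpperHalf p (1, 0)) p.1 := by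
  have h1 : HasDerivAt (fun s : ℝ => (s, p.2)) ((1 : ℝ), (0 : ℝ)) p.1 :=
    (hasDerivAt_id p.1).prodMk (hasDerivAt_const p.1 p.2)
  exact ((hg p hp).hasFDerivWithinAt).comp_hasDerivAt_of_eq p.1 h1
    (Filter.Eventually.of_forall fun s => hp) rfl

theorem hasDerivWithinAt_snd_of_differentiableOn {g : ℝ × ℝ → ℂ}
    (hg : DifferentiableOn ℝ g closedUpperHalf) {p : ℝ × ℝ} (hp : p ∈ closedUpperHalf) :
    HasDerivWithinAt (fun t : ℝ => g (p.1, t)) (fderivWithin ℝ g closedUpperHalf p (0, 1))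
      (Ici 0) p.2 := by
  have h1 : HasDerivWithinAt (fun t : ℝ => (p.1, t)) ((0 : ℝ), (1 : ℝ)) (Ici 0) p.2 :=
    ((hasDerivAt_const p.2 p.1).prodMk (hasDerivAt_id p.2)).hasDerivWithinAt
  exact ((hg p hp).hasFDerivWithinAt).comp_hasDerivWithinAt_of_eq p.2 h1
    (fun t ht => ht) rfl

theorem pd1_eq_of_hasDerivAt {g : ℝ × ℝ → ℂ} {p : ℝ × ℝ} {d : ℂ}
    (h : HasDerivAt (fun s : ℝ => g (s, p.2)) d p.1) : pd1 g p = d := h.deriv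

theorem pd2_eq_of_hasDerivWithinAt {g : ℝ × ℝ → ℂ} {p : ℝ × ℝ} (hp : p ∈ closedUpperHalf) {d : ℂ}
    (h : HasDerivWithinAt (fun t : ℝ => g (p.1, t)) d (Ici 0) p.2) : pd2 g p = d :=
  h.derivWithin (uniqueDiffOn_Ici 0 p.2 hp)

theorem pd1_eq_fderivWithin {g : ℝ × ℝ → ℂ} (hg : DifferentiableOn ℝ g closedUpperHalf)
    {p : ℝ × ℝ} (hp : p ∈ closedUpperHalf) :
    pd1 g p = fderivWithin ℝ g closedUpperHalf p (1, 0) :=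
  pd1_eq_of_hasDerivAt (hasDerivAt_fst_of_differentiableOn hg hp)

theorem pd2_eq_fderivWithin {g : ℝ × ℝ → ℂ} (hg : DifferentiableOn ℝ g closedUpperHalf)
    {p : ℝ × ℝ} (hp : p ∈ closedUpperHalf) :
    pd2 g p = fderivWithin ℝ g closedUpperHalf p (0, 1) :=
  pd2_eq_of_hasDerivWithinAt hp (hasDerivWithinAt_snd_of_differentiableOn hg hp)

theorem hasDerivAt_pd1 {g : ℝ × ℝ → ℂ} (hg : DifferentiableOn ℝ g closedUpperHalf)
    {p : ℝ × ℝ} (hp : p ∈ closedUpperHalf) :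
    HasDerivAt (fun s : ℝ => g (s, p.2)) (pd1 g p) p.1 := by
  rw [pd1_eq_fderivWithin hg hp]
  exact hasDerivAt_fst_of_differentiableOn hg hp

theorem hasDerivWithinAt_pd2 {g : ℝ × ℝ → ℂ} (hg : DifferentiableOn ℝ g closedUpperHalf)
    {p : ℝ × ℝ} (hp : p ∈ closedUpperHalf) :
    HasDerivWithinAt (fun t : ℝ => g (p.1, t)) (pd2 g p) (Ici 0) p.2 := by
  rw [pd2_eq_fderivWithin hg hp]
  exact hasDerivWithinAt_snd_of_differentiableOn hg hp

theorem ContDiffOn.pd1 {g : ℝ × ℝ → ℂ} (hg : ContDiffOn ℝ 2 g closedUpperHalf) :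
    ContDiffOn ℝ 1 (pd1 g) closedUpperHalf :=
  ((hg.fderivWithin uniqueDiffOn_closedUpperHalf (m := 1) (by norm_num)).clm_apply
    contDiffOn_const).congr fun _ hp => pd1_eq_fderivWithin (hg.differentiableOn (by norm_num)) hp

theorem ContDiffOn.pd2 {g : ℝ × ℝ → ℂ} (hg : ContDiffOn ℝ 2 g closedUpperHalf) :
    ContDiffOn ℝ 1 (pd2 g) closedUpperHalf :=
  ((hg.fderivWithin uniqueDiffOn_closedUpperHalf (m := 1) (by norm_num)).clm_apply
    contDiffOn_const).congr fun _ hp => pd2_eq_fderivWithin (hg.differentiableOn (by norm_num)) hp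

theorem contDiff_surfaceWave (κ : ℂ) (ν : ℝ) : ContDiff ℝ 1 (surfaceWave κ ν) := by
  have h1 : ContDiff ℝ 1 (fun p : ℝ × ℝ => (p.1 : ℂ)) :=
    Complex.ofRealCLM.contDiff.comp contDiff_fst
  have h2 : ContDiff ℝ 1 (fun p : ℝ × ℝ => (p.2 : ℂ)) :=
    Complex.ofRealCLM.contDiff.comp contDiff_snd
  exact ((contDiff_const.mul h1).sub (contDiff_const.mul h2)).cexp

theorem hasDerivAt_surfaceWave_fst (κ : ℂ) (ν : ℝ) (p : ℝ × ℝ) :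
    HasDerivAt (fun s : ℝ => surfaceWave κ ν (s, p.2)) (Complex.I * κ * surfaceWave κ ν p) p.1 := by
  have h := (((hasDerivAt_id p.1).ofReal_comp.const_mul (Complex.I * κ)).sub_const
    ((ν : ℂ) * p.2)).cexp
  refine h.congr_deriv ?_
  simp [surfaceWave, mul_comm]

theorem hasDerivAt_surfaceWave_snd (κ : ℂ) (ν : ℝ) (p : ℝ × ℝ) :
    HasDerivAt (fun t : ℝ => surfaceWave κ ν (p.1, t)) (-ν * surfaceWave κ ν p) p.2 := by
  have h := (((hasDerivAt_id p.2).ofReal_comp.const_mul (ν : ℂ)).const_sub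
    (Complex.I * κ * p.1)).cexp
  refine h.congr_deriv ?_
  simp [surfaceWave, mul_comm]

theorem norm_surfaceWave_le (κ : ℂ) (ν : ℝ) (p : ℝ × ℝ) :
    ‖surfaceWave κ ν p‖ ≤ Real.exp (|κ.im| * |p.1|) * Real.exp (-ν * p.2) := by
  rw [surfaceWave, Complex.norm_exp, ← Real.exp_add, Real.exp_le_exp]
  have : -(κ.im * p.1) ≤ |κ.im| * |p.1| := by
    rw [← abs_mul]; exact neg_le_abs _
  simp
  linarith

theorem surfaceWave_neg_mul (κ : ℂ) (ν : ℝ) (p : ℝ × ℝ) :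
    surfaceWave (-κ) ν p * surfaceWave κ ν p = (Real.exp (-(2 * ν) * p.2) : ℂ) := by
  rw [surfaceWave, surfaceWave, ← Complex.exp_add]
  push_cast
  congr 1
  ring

theorem volume_snd_eq_zero : ∀ᵐ p : ℝ × ℝ, p.2 ≠ 0 := by
  have : {p : ℝ × ℝ | ¬ p.2 ≠ 0} = univ ×ˢ {(0 : ℝ)} := by ext p; simp
  rw [ae_iff, this, Measure.volume_eq_prod, Measure.prod_prod]
  simp

/-- Green's identity on the rectangle `[-R, R] × [0, T]`, tested against `surfaceWave κ ν`. -/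
theorem green_rectangle {ν ε : ℝ} {κ : ℂ} (hκ : κ ^ 2 = (ν : ℂ) ^ 2 - Complex.I * ε)
    {f u : ℝ × ℝ → ℂ} (hf : Continuous f) (hu : ContDiffOn ℝ 2 u closedUpperHalf)
    (heq : ∀ p ∈ upperHalf, pd1 (pd1 u) p + pd2 (pd2 u) p - Complex.I * ε * u p = f p)
    (hbc : ∀ x₁ : ℝ, -pd2 u (x₁, 0) = ν * u (x₁, 0))
    {R T : ℝ} (hR : 0 ≤ R) (hT : 0 ≤ T) :
    ∫ p in Icc (-R, 0) (R, T), f p * surfaceWave κ ν p =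
      (∫ x in -R..R, (pd2 u (x, T) + ν * u (x, T)) * surfaceWave κ ν (x, T)) +
      (∫ y in (0 : ℝ)..T, (pd1 u (R, y) - Complex.I * κ * u (R, y)) * surfaceWave κ ν (R, y)) -
      ∫ y in (0 : ℝ)..T,
        (pd1 u (-R, y) - Complex.I * κ * u (-R, y)) * surfaceWave κ ν (-R, y) := by
  set F : ℝ × ℝ → ℂ := fun p => (pd1 u p - Complex.I * κ * u p) * surfaceWave κ ν p with hF
  set G : ℝ × ℝ → ℂ := fun p => (pd2 u p + ν * u p) * surfaceWave κ ν p with hG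
  have hu1 : ContDiffOn ℝ 1 u closedUpperHalf := hu.of_le (by norm_num)
  have hFc : ContDiffOn ℝ 1 F closedUpperHalf :=
    (hu.pd1.sub (contDiffOn_const.mul hu1)).mul (contDiff_surfaceWave κ ν).contDiffOn
  have hGc : ContDiffOn ℝ 1 G closedUpperHalf :=
    (hu.pd2.add (contDiffOn_const.mul hu1)).mul (contDiff_surfaceWave κ ν).contDiffOn
  have hsub : Icc (-R, (0 : ℝ)) (R, T) ⊆ closedUpperHalf := fun p hp => hp.1.2
  have hdiv : ∀ p : ℝ × ℝ, 0 < p.2 → fderivWithin ℝ F closedUpperHalf p (1, 0) +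
      fderivWithin ℝ G closedUpperHalf p (0, 1) = f p * surfaceWave κ ν p := by
    intro p hp
    have hpH : p ∈ closedUpperHalf := hp.le
    rw [← pd1_eq_fderivWithin (hFc.differentiableOn one_ne_zero) hpH,
      ← pd2_eq_fderivWithin (hGc.differentiableOn one_ne_zero) hpH,
      pd1_eq_of_hasDerivAt (((hasDerivAt_pd1 (hu.pd1.differentiableOn one_ne_zero) hpH).sub
        ((hasDerivAt_pd1 (hu1.differentiableOn one_ne_zero) hpH).const_mul (Complex.I * κ))).mul
        (hasDerivAt_surfaceWave_fst κ ν p)),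
      pd2_eq_of_hasDerivWithinAt hpH
        (((hasDerivWithinAt_pd2 (hu.pd2.differentiableOn one_ne_zero) hpH).add
        ((hasDerivWithinAt_pd2 (hu1.differentiableOn one_ne_zero) hpH).const_mul (ν : ℂ))).mul
        (hasDerivAt_surfaceWave_snd κ ν p).hasDerivWithinAt), ← heq p hp]
    simp only [Pi.sub_apply, Pi.add_apply, Prod.mk.eta]
    linear_combination (u p * surfaceWave κ ν p) * hκ -
      κ ^ 2 * u p * surfaceWave κ ν p * Complex.I_sq
  have hae : (fun p => fderivWithin ℝ F closedUpperHalf p (1, 0) +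
      fderivWithin ℝ G closedUpperHalf p (0, 1)) =ᵐ[volume.restrict (Icc (-R, (0 : ℝ)) (R, T))]
      fun p => f p * surfaceWave κ ν p := by
    filter_upwards [ae_restrict_mem measurableSet_Icc, ae_restrict_of_ae volume_snd_eq_zero]
      with p hp hp0
    exact hdiv p (lt_of_le_of_ne (hsub hp) hp0.symm)
  have hint : IntegrableOn (fun p => f p * surfaceWave κ ν p) (Icc (-R, (0 : ℝ)) (R, T)) :=
    (hf.mul (contDiff_surfaceWave κ ν).continuous).continuousOn.integrableOn_compact isCompact_Icc
  have hpt : ∀ {g : ℝ × ℝ → ℂ}, ContDiffOn ℝ 1 g closedUpperHalf →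
      ∀ p ∈ Ioo (-R) R ×ˢ Ioo 0 T, HasFDerivAt g (fderivWithin ℝ g closedUpperHalf p) p := by
    intro g hg p hp
    have hp2 : 0 < p.2 := hp.2.1
    exact ((hg.differentiableOn one_ne_zero p hp2.le).hasFDerivWithinAt).hasFDerivAt
      (closedUpperHalf_mem_nhds hp2)
  have key := integral_divergence_prod_Icc_of_hasFDerivAt_of_le F G
    (fderivWithin ℝ F closedUpperHalf) (fderivWithin ℝ G closedUpperHalf) (-R, 0) (R, T)
    ⟨by simpa using (by linarith : -R ≤ R), hT⟩ (hFc.continuousOn.mono hsub)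
    (hGc.continuousOn.mono hsub) (hpt hFc) (hpt hGc) (hint.congr hae.symm)
  rw [integral_congr_ae hae] at key
  have hG0 : ∀ x : ℝ, G (x, 0) = 0 := by
    intro x
    simp only [hG]
    rw [← hbc x]
    simp
  simpa [hG0] using key

theorem setIntegral_upperHalf_eq_Icc {g : ℝ × ℝ → ℂ} {R T : ℝ}
    (hg : ∀ p ∉ Icc (-R, -T) (R, T), g p = 0) :
    ∫ p in upperHalf, g p = ∫ p in Icc (-R, 0) (R, T), g p := by
  have hm : MeasurableSet upperHalf := measurableSet_lt measurable_const measurable_snd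
  rw [← integral_indicator hm, ← integral_indicator measurableSet_Icc]
  refine integral_congr_ae ?_
  filter_upwards [volume_snd_eq_zero] with p hp
  by_cases h : p ∈ Icc (-R, -T) (R, T)
  · have : p ∈ upperHalf ↔ p ∈ Icc (-R, (0 : ℝ)) (R, T) := by
      constructor
      · intro h0
        exact ⟨⟨h.1.1, le_of_lt h0⟩, h.2⟩
      · intro h0
        exact lt_of_le_of_ne h0.1.2 hp.symm
    by_cases h0 : p ∈ Icc (-R, (0 : ℝ)) (R, T)
    · rw [indicator_of_mem (this.2 h0), indicator_of_mem h0]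
    · rw [indicator_of_notMem (mt this.1 h0), indicator_of_notMem h0]
  · simp [indicator, hg p h]

theorem norm_integral_sub_exp_le {ν K T : ℝ} (hν : 0 < ν) (hK : 0 ≤ K) (hT : 0 ≤ T) {F : ℝ → ℂ}
    {c : ℂ} (hFc : ContinuousOn F (Icc 0 T))
    (hF : ∀ y ∈ Icc 0 T, ‖F y - c * (Real.exp (-(2 * ν) * y) : ℂ)‖ ≤ K * Real.exp (-ν * y)) :
    ‖(∫ y in (0 : ℝ)..T, F y) - c * (((1 - Real.exp (-(2 * ν) * T)) / (2 * ν) : ℝ) : ℂ)‖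
      ≤ K / ν := by
  have hexp : ∀ {b : ℝ}, 0 < b →
      ∫ y in (0 : ℝ)..T, Real.exp (-b * y) = (1 - Real.exp (-b * T)) / b := by
    intro b hb
    have h := fun y (_ : y ∈ uIcc 0 T) =>
      (((hasDerivAt_id y).const_mul (-b)).exp.div_const (-b)).congr_deriv
        (show Real.exp (-b * y) * (-b * 1) / (-b) = Real.exp (-b * y) by field_simp)
    rw [intervalIntegral.integral_eq_sub_of_hasDerivAt h
      (by apply Continuous.intervalIntegrable; fun_prop)]
    simp only [id, mul_zero, Real.exp_zero]
    field_simp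
    ring
  have h1 : c * (((1 - Real.exp (-(2 * ν) * T)) / (2 * ν) : ℝ) : ℂ) =
      ∫ y in (0 : ℝ)..T, c * (Real.exp (-(2 * ν) * y) : ℂ) := by
    rw [intervalIntegral.integral_const_mul, intervalIntegral.integral_ofReal,
      hexp (by positivity : 0 < 2 * ν)]
  rw [h1, ← intervalIntegral.integral_sub]
  · refine (intervalIntegral.norm_integral_le_of_norm_le (g := fun y => K * Real.exp (-ν * y)) hT
      (Filter.Eventually.of_forall fun y hy => hF y ⟨hy.1.le, hy.2⟩)
      (by apply Continuous.intervalIntegrable; fun_prop)).trans ?_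
    rw [intervalIntegral.integral_const_mul, hexp hν, ← mul_div_assoc]
    gcongr
    have := Real.exp_pos (-ν * T)
    nlinarith
  · rw [intervalIntegrable_iff_integrableOn_Icc_of_le hT]
    exact hFc.integrableOn_Icc
  · apply Continuous.intervalIntegrable; fun_prop

theorem norm_lateral_flux_le {ν : ℝ} {κ : ℂ} {u uu : ℝ × ℝ → ℂ}
    (hu : DifferentiableOn ℝ u closedUpperHalf) {A B : ℝ → ℂ} {C a : ℝ}
    (hrep : ∀ p : ℝ × ℝ, 0 ≤ p.2 →
      u p = A p.1 * surfaceWave (-κ) ν p + B p.1 * surfaceWave κ ν p + uu p)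
    (hdec : ∀ p : ℝ × ℝ, 0 ≤ p.2 →
      ‖uu p‖ + ‖pd1 uu p‖ + ‖pd2 uu p‖ ≤ C * Real.exp (-a * Real.sqrt (1 + p.1 ^ 2)))
    (hC : 0 ≤ C) (ha : 0 ≤ a) {x : ℝ} (hA : HasDerivAt A 0 x) (hB : HasDerivAt B 0 x)
    {y : ℝ} (hy : 0 ≤ y) :
    ‖(pd1 u (x, y) - Complex.I * κ * u (x, y)) * surfaceWave κ ν (x, y) -
        (-2 * Complex.I * κ * A x) * (Real.exp (-(2 * ν) * y) : ℂ)‖ ≤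
      (1 + ‖κ‖) * C * Real.exp (-(a - |κ.im|) * |x|) * Real.exp (-ν * y) := by
  have hpd : pd1 uu (x, y) = pd1 u (x, y) -
      (0 * surfaceWave (-κ) ν (x, y) + A x * (Complex.I * -κ * surfaceWave (-κ) ν (x, y)) +
        (0 * surfaceWave κ ν (x, y) + B x * (Complex.I * κ * surfaceWave κ ν (x, y)))) := by
    refine pd1_eq_of_hasDerivAt (((hasDerivAt_pd1 hu (p := (x, y)) hy).sub
      ((hA.mul (hasDerivAt_surfaceWave_fst (-κ) ν (x, y))).add
        (hB.mul (hasDerivAt_surfaceWave_fst κ ν (x, y))))).congr_of_eventuallyEq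
        (Filter.Eventually.of_forall fun s => ?_))
    have := hrep (s, y) hy
    simp only [Pi.sub_apply, Pi.add_apply, Pi.mul_apply]
    linear_combination -this
  have hid : (pd1 u (x, y) - Complex.I * κ * u (x, y)) * surfaceWave κ ν (x, y) -
      (-2 * Complex.I * κ * A x) * (Real.exp (-(2 * ν) * y) : ℂ) =
      (pd1 uu (x, y) - Complex.I * κ * uu (x, y)) * surfaceWave κ ν (x, y) := by
    have h1 := surfaceWave_neg_mul κ ν (x, y)
    rw [hpd, hrep (x, y) hy]
    linear_combination (2 * Complex.I * κ * A x) * (-h1)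
  have hd := hdec (x, y) hy
  have hw := norm_surfaceWave_le κ ν (x, y)
  have hsq : |x| ≤ Real.sqrt (1 + x ^ 2) := Real.abs_le_sqrt (by linarith)
  have h1 : ‖pd1 uu (x, y) - Complex.I * κ * uu (x, y)‖ ≤
      (1 + ‖κ‖) * (C * Real.exp (-a * |x|)) := by
    have h2 : ‖uu (x, y)‖ + ‖pd1 uu (x, y)‖ + ‖pd2 uu (x, y)‖ ≤ C * Real.exp (-a * |x|) := by
      refine hd.trans ?_
      gcongr C * Real.exp ?_
      simp only
      nlinarith
    have h3 := norm_sub_le (pd1 uu (x, y)) (Complex.I * κ * uu (x, y))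
    rw [norm_mul, norm_mul, Complex.norm_I, one_mul] at h3
    have := norm_nonneg (uu (x, y))
    have := norm_nonneg (pd1 uu (x, y))
    have := norm_nonneg (pd2 uu (x, y))
    have := mul_le_mul_of_nonneg_left
      (by linarith : ‖uu (x, y)‖ ≤ C * Real.exp (-a * |x|)) (norm_nonneg κ)
    linarith
  rw [hid, norm_mul]
  calc _ ≤ (1 + ‖κ‖) * (C * Real.exp (-a * |x|)) *
        (Real.exp (|κ.im| * |x|) * Real.exp (-ν * y)) := by
        gcongr
    _ = (1 + ‖κ‖) * C * (Real.exp (-a * |x|) * Real.exp (|κ.im| * |x|)) * Real.exp (-ν * y) := by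
        ring
    _ = _ := by
        rw [← Real.exp_add]
        ring_nf

theorem norm_top_flux_le {ν : ℝ} (hν : 0 ≤ ν) {κ : ℂ} {u uu : ℝ × ℝ → ℂ}
    (hu : DifferentiableOn ℝ u closedUpperHalf) {A B : ℝ → ℂ} {C a : ℝ}
    (hrep : ∀ p : ℝ × ℝ, 0 ≤ p.2 →
      u p = A p.1 * surfaceWave (-κ) ν p + B p.1 * surfaceWave κ ν p + uu p)
    (hdec : ∀ p : ℝ × ℝ, 0 ≤ p.2 →
      ‖uu p‖ + ‖pd1 uu p‖ + ‖pd2 uu p‖ ≤ C * Real.exp (-a * Real.sqrt (1 + p.1 ^ 2)))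
    (hC : 0 ≤ C) (ha : 0 ≤ a) {R x y : ℝ} (hx : |x| ≤ R) (hy : 0 ≤ y) :
    ‖(pd2 u (x, y) + ν * u (x, y)) * surfaceWave κ ν (x, y)‖ ≤
      (1 + ν) * C * Real.exp (|κ.im| * R) * Real.exp (-ν * y) := by
  have hpd : pd2 uu (x, y) = pd2 u (x, y) -
      (A x * (-ν * surfaceWave (-κ) ν (x, y)) + B x * (-ν * surfaceWave κ ν (x, y))) := by
    refine pd2_eq_of_hasDerivWithinAt (p := (x, y)) hy
      (((hasDerivWithinAt_pd2 hu (p := (x, y)) hy).sub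
      ((((hasDerivAt_surfaceWave_snd (-κ) ν (x, y)).const_mul (A x)).add
        ((hasDerivAt_surfaceWave_snd κ ν (x, y)).const_mul (B x))).hasDerivWithinAt)).congr_of_mem
        (fun t ht => ?_) hy)
    have := hrep (x, t) ht
    simp only [Pi.sub_apply, Pi.add_apply]
    linear_combination -this
  have hid : pd2 u (x, y) + ν * u (x, y) = pd2 uu (x, y) + ν * uu (x, y) := by
    rw [hpd, hrep (x, y) hy]
    ring
  have h1 : ‖pd2 uu (x, y) + ν * uu (x, y)‖ ≤ (1 + ν) * C := by
    have h2 : ‖uu (x, y)‖ + ‖pd1 uu (x, y)‖ + ‖pd2 uu (x, y)‖ ≤ C := by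
      refine (hdec (x, y) hy).trans (mul_le_of_le_one_right hC (Real.exp_le_one_iff.2 ?_))
      have := Real.sqrt_nonneg (1 + x ^ 2)
      simp only
      nlinarith
    have h3 := norm_add_le (pd2 uu (x, y)) (ν * uu (x, y))
    rw [norm_mul, Complex.norm_real, Real.norm_of_nonneg hν] at h3
    have := norm_nonneg (uu (x, y))
    have := norm_nonneg (pd1 uu (x, y))
    have := norm_nonneg (pd2 uu (x, y))
    have := mul_le_mul_of_nonneg_left (by linarith : ‖uu (x, y)‖ ≤ C) hν
    linarith
  have hw := norm_surfaceWave_le κ ν (x, y)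
  rw [hid, norm_mul, mul_assoc _ (Real.exp _)]
  refine mul_le_mul h1 (hw.trans ?_) (norm_nonneg _) (by positivity)
  gcongr

/-- If a solution is asymptotic to `c₁ e^{−iκx₁ − νx₂}` as `x₁ → ∞` and to `c₂ e^{−iκx₁ − νx₂}` as
`x₁ → −∞`, up to multiples of `e^{iκx₁ − νx₂}` and a remainder decaying faster than `e^{iκx₁}` can
grow, then testing the equation against `e^{iκx₁ − νx₂}` recovers `c₁ − c₂`. -/
theorem integral_mul_surfaceWave_eq {ν ε : ℝ} (hν : 0 < ν) {κ : ℂ}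
    (hκ : κ ^ 2 = (ν : ℂ) ^ 2 - Complex.I * ε)
    {f u uu : ℝ × ℝ → ℂ} (hf : Continuous f) (hfsupp : HasCompactSupport f)
    (hu : ContDiffOn ℝ 2 u closedUpperHalf)
    (heq : ∀ p ∈ upperHalf, pd1 (pd1 u) p + pd2 (pd2 u) p - Complex.I * ε * u p = f p)
    (hbc : ∀ x₁ : ℝ, -pd2 u (x₁, 0) = ν * u (x₁, 0))
    {A B : ℝ → ℂ} {M : ℝ} {c₁ c₂ : ℂ}
    (hA₁ : ∀ x, M < x → A x = c₁) (hA₂ : ∀ x, x < -M → A x = c₂)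
    (hdA : ∀ x, M < |x| → HasDerivAt A 0 x) (hdB : ∀ x, M < |x| → HasDerivAt B 0 x)
    {C a : ℝ} (hC : 0 ≤ C) (ha : |κ.im| < a)
    (hrep : ∀ p : ℝ × ℝ, 0 ≤ p.2 →
      u p = A p.1 * surfaceWave (-κ) ν p + B p.1 * surfaceWave κ ν p + uu p)
    (hdec : ∀ p : ℝ × ℝ, 0 ≤ p.2 →
      ‖uu p‖ + ‖pd1 uu p‖ + ‖pd2 uu p‖ ≤ C * Real.exp (-a * Real.sqrt (1 + p.1 ^ 2))) :
    ∫ p in upperHalf, f p * surfaceWave κ ν p = -(Complex.I * κ / ν) * (c₁ - c₂) := by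
  have ha0 : 0 ≤ a := (abs_nonneg _).trans ha.le
  have hu1 : ContDiffOn ℝ 1 u closedUpperHalf := hu.of_le (by norm_num)
  have hud : DifferentiableOn ℝ u closedUpperHalf := hu1.differentiableOn one_ne_zero
  obtain ⟨ρ, hρ⟩ := hfsupp.isCompact.isBounded.subset_closedBall 0
  have hf0 : ∀ p : ℝ × ℝ, ¬ ‖p‖ ≤ ρ → f p = 0 := fun p hp =>
    image_eq_zero_of_notMem_tsupport fun h => hp (by simpa using hρ h)
  set J := ∫ p in upperHalf, f p * surfaceWave κ ν p with hJ
  set K : ℝ → ℝ := fun R => (1 + ‖κ‖) * C * Real.exp (-(a - |κ.im|) * R) with hK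
  have hmain : ∀ R T : ℝ, M < R → 0 < R → ρ ≤ R → 0 ≤ T → ρ ≤ T →
      ‖J - (-2 * Complex.I * κ * (c₁ - c₂)) *
        (((1 - Real.exp (-(2 * ν) * T)) / (2 * ν) : ℝ) : ℂ)‖ ≤
      (1 + ν) * C * Real.exp (|κ.im| * R) * Real.exp (-ν * T) * |R - -R| + 2 * (K R / ν) := by
    intro R T hMR hR hρR hT hρT
    have hbox : J = ∫ p in Icc (-R, 0) (R, T), f p * surfaceWave κ ν p := by
      refine setIntegral_upperHalf_eq_Icc fun p hp => ?_
      rw [hf0 p, zero_mul]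
      intro hpρ
      have h1 := abs_le.1 ((norm_fst_le p).trans (hpρ.trans hρR))
      have h2 := abs_le.1 ((norm_snd_le p).trans (hpρ.trans hρT))
      exact hp ⟨⟨h1.1, h2.1⟩, ⟨h1.2, h2.2⟩⟩
    rw [green_rectangle hκ hf hu heq hbc hR.le hT] at hbox
    have hcont : ∀ x : ℝ, ContinuousOn (fun y : ℝ =>
        (pd1 u (x, y) - Complex.I * κ * u (x, y)) * surfaceWave κ ν (x, y)) (Icc 0 T) := by
      intro x
      refine ContinuousOn.comp (g := fun p : ℝ × ℝ =>
        (pd1 u p - Complex.I * κ * u p) * surfaceWave κ ν p) (t := closedUpperHalf)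
        ((hu.pd1.continuousOn.sub (continuousOn_const.mul hu1.continuousOn)).mul
          (contDiff_surfaceWave κ ν).continuous.continuousOn)
        (by fun_prop) fun y hy => hy.1
    have hK0 : 0 ≤ K R := by positivity
    have hlat : ∀ x : ℝ, |x| = R → _ := fun x hx =>
      norm_integral_sub_exp_le (c := -2 * Complex.I * κ * A x) hν hK0 hT (hcont x)
        fun y hy => by
          have := norm_lateral_flux_le hud hrep hdec hC ha0 (hdA x (hx ▸ hMR))
            (hdB x (hx ▸ hMR)) hy.1
          rwa [hx] at this
    have hright := hlat R (abs_of_pos hR)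
    have hleft := hlat (-R) (by rw [abs_neg, abs_of_pos hR])
    rw [hA₁ R hMR] at hright
    rw [hA₂ (-R) (by linarith)] at hleft
    have htop := intervalIntegral.norm_integral_le_of_norm_le_const (a := -R) (b := R)
      (f := fun x => (pd2 u (x, T) + ν * u (x, T)) * surfaceWave κ ν (x, T)) fun x hx =>
        norm_top_flux_le hν.le hud hrep hdec hC ha0 (R := R) (abs_le.2 (by
          rw [uIoc_of_le (by linarith)] at hx
          exact ⟨hx.1.le, hx.2⟩)) hT
    refine le_trans (le_of_eq (congrArg norm ?_))
      ((norm_sub_le _ _).trans (add_le_add ((norm_add_le _ _).trans (add_le_add htop hright))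
        hleft) |>.trans (le_of_eq (by ring)))
    rw [hbox]
    ring
  have hexp : ∀ {b : ℝ}, 0 < b →
      Filter.Tendsto (fun T : ℝ => Real.exp (-b * T)) Filter.atTop (nhds 0) := by
    intro b hb
    exact Real.tendsto_exp_atBot.comp
      (Filter.tendsto_id.const_mul_atTop_of_neg (neg_lt_zero.2 hb))
  have hlimT : ∀ R : ℝ, M < R → 0 < R → ρ ≤ R →
      ‖J - (-2 * Complex.I * κ * (c₁ - c₂)) * (((1 - 0) / (2 * ν) : ℝ) : ℂ)‖ ≤
        (1 + ν) * C * Real.exp (|κ.im| * R) * 0 * |R - -R| + 2 * (K R / ν) := by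
    intro R h1 h2 h3
    refine le_of_tendsto_of_tendsto (tendsto_const_nhds.sub (tendsto_const_nhds.mul
      ((Complex.continuous_ofReal.tendsto _).comp
        (((hexp (by positivity : 0 < 2 * ν)).const_sub 1).div_const (2 * ν))))).norm
      ((((hexp hν).const_mul _).mul_const _).add_const _) ?_
    filter_upwards [Filter.eventually_ge_atTop 0, Filter.eventually_ge_atTop ρ] with T h4 h5
    exact hmain R T h1 h2 h3 h4 h5
  have hlimR : ‖J - (-2 * Complex.I * κ * (c₁ - c₂)) * (((1 - 0) / (2 * ν) : ℝ) : ℂ)‖ ≤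
      2 * ((1 + ‖κ‖) * C * 0 / ν) := by
    refine ge_of_tendsto ((((hexp (sub_pos.2 ha)).const_mul _).div_const ν).const_mul 2) ?_
    filter_upwards [Filter.eventually_gt_atTop M, Filter.eventually_gt_atTop 0,
      Filter.eventually_ge_atTop ρ] with R h1 h2 h3
    refine (hlimT R h1 h2 h3).trans (le_of_eq ?_)
    rw [mul_zero, zero_mul, zero_add]
  have h0 : J - (-2 * Complex.I * κ * (c₁ - c₂)) * (((1 - 0) / (2 * ν) : ℝ) : ℂ) = 0 :=
    norm_le_zero_iff.1 (by simpa using hlimR)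
  have hν' : (ν : ℂ) ≠ 0 := by exact_mod_cast hν.ne'
  rw [sub_eq_zero.1 h0]
  push_cast
  field_simp
  ring

/-- The amplitudes of the outgoing waves at infinity are given by Green's-identity
formulas: if `Δu − iεu = f` in `ℝ²₊` with the free-surface condition, and
`u = b₁χ(x₁)e^{−iμx₁−νx₂} + b₂χ(−x₁)e^{iμx₁−νx₂} + uu` with `uu` exponentially decaying,
then `b₁ = iνμ⁻¹ ∫ f e^{iμx₁−νx₂}` and `b₂ = iνμ⁻¹ ∫ f e^{−iμx₁−νx₂}`. -/
theorem outgoing_amplitudes (ν ε : ℝ) (hν : 0 < ν) (hε : 0 ≤ ε) (μ : ℂ)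
    (hμ : μ ^ 2 = (ν : ℂ) ^ 2 - Complex.I * ε) (hμre : 0 < μ.re)
    (N : ℝ) (hN : 0 < N) (χ : ℝ → ℝ) (hχ : ContDiff ℝ (⊤ : ℕ∞) χ)
    (hχ0 : ∀ t : ℝ, t ≤ N → χ t = 0) (hχ1 : ∀ t : ℝ, 2 * N ≤ t → χ t = 1)
    (f : ℝ × ℝ → ℂ) (hf : Continuous f) (hfsupp : HasCompactSupport f)
    (u : ℝ × ℝ → ℂ) (hu : ContDiffOn ℝ 2 u {p : ℝ × ℝ | 0 ≤ p.2})
    (heq : ∀ p ∈ upperHalf, pd1 (pd1 u) p + pd2 (pd2 u) p - Complex.I * ε * u p = f p)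
    (hbc : ∀ x₁ : ℝ, -pd2 u (x₁, 0) = ν * u (x₁, 0))
    (b₁ b₂ : ℂ) (uu : ℝ × ℝ → ℂ) (C a : ℝ) (hC : 0 < C) (ha : ε / (2 * ν) < a)
    (hrep : ∀ p : ℝ × ℝ, 0 ≤ p.2 →
      u p = b₁ * χ p.1 * Complex.exp (-Complex.I * μ * p.1 - ν * p.2)
        + b₂ * χ (-p.1) * Complex.exp (Complex.I * μ * p.1 - ν * p.2) + uu p)
    (hdec : ∀ p : ℝ × ℝ, 0 ≤ p.2 →
      ‖uu p‖ + ‖pd1 uu p‖ + ‖pd2 uu p‖ ≤ C * Real.exp (-a * Real.sqrt (1 + p.1 ^ 2))) :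
    b₁ = Complex.I * ν * μ⁻¹ *
        ∫ p in upperHalf, f p * Complex.exp (Complex.I * μ * p.1 - ν * p.2) ∧
    b₂ = Complex.I * ν * μ⁻¹ *
        ∫ p in upperHalf, f p * Complex.exp (-Complex.I * μ * p.1 - ν * p.2) := by
  have him : |μ.im| < a := by
    refine lt_of_le_of_lt ?_ ha
    have hre := congrArg Complex.re hμ
    have him := congrArg Complex.im hμ
    simp [pow_two] at hre him
    have h1 : ν ≤ μ.re := by nlinarith [sq_nonneg μ.im]
    have h2 : |μ.im| * (2 * μ.re) = ε := by
      rw [← abs_of_pos (by linarith : 0 < 2 * μ.re), ← abs_mul, ← abs_of_nonneg hε, ← abs_neg ε]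
      congr 1
      linarith
    rw [le_div_iff₀ (by positivity)]
    nlinarith [abs_nonneg μ.im]
  have hμ0 : μ ≠ 0 := fun h => by simp [h] at hμre
  have hν0 : (ν : ℂ) ≠ 0 := by exact_mod_cast hν.ne'
  have hχ2 : ∀ (b : ℂ) (x : ℝ), 2 * N < |x| → HasDerivAt (fun t => b * (χ t : ℂ)) 0 x := by
    intro b x hx
    rcases lt_abs.1 hx with h | h
    · refine (hasDerivAt_const x (b * (1 : ℝ))).congr_of_eventuallyEq ?_
      filter_upwards [lt_mem_nhds h] with t ht
      rw [hχ1 t ht.le]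
    · refine (hasDerivAt_const x (b * (0 : ℝ))).congr_of_eventuallyEq ?_
      filter_upwards [gt_mem_nhds (by linarith : x < N)] with t ht
      rw [hχ0 t ht.le]
  have hχ2' : ∀ (b : ℂ) (x : ℝ), 2 * N < |x| → HasDerivAt (fun t => b * (χ (-t) : ℂ)) 0 x := by
    intro b x hx
    exact ((hχ2 b (-x) (by rwa [abs_neg])).scomp x (hasDerivAt_neg x)).congr_deriv (smul_zero _)
  have hwave : ∀ p : ℝ × ℝ, Complex.exp (Complex.I * μ * p.1 - ν * p.2) = surfaceWave μ ν p :=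
    fun _ => rfl
  have hwave' : ∀ p : ℝ × ℝ,
      Complex.exp (-Complex.I * μ * p.1 - ν * p.2) = surfaceWave (-μ) ν p := by
    intro p
    rw [surfaceWave, mul_neg, neg_mul Complex.I]
  simp only [hwave, hwave'] at hrep ⊢
  have h1 := integral_mul_surfaceWave_eq hν hμ hf hfsupp hu heq hbc (M := 2 * N)
    (A := fun t => b₁ * (χ t : ℂ)) (B := fun t => b₂ * (χ (-t) : ℂ)) (c₁ := b₁) (c₂ := 0)
    (fun x hx => by simp [hχ1 x hx.le])
    (fun x hx => by simp [hχ0 x (by linarith)]) (hχ2 b₁) (hχ2' b₂) hC.le him hrep hdec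
  have h2 := integral_mul_surfaceWave_eq hν (κ := -μ) (by rw [neg_sq, hμ]) hf hfsupp hu heq hbc
    (M := 2 * N) (A := fun t => b₂ * (χ (-t) : ℂ)) (B := fun t => b₁ * (χ t : ℂ))
    (c₁ := 0) (c₂ := b₂) (fun x hx => by simp [hχ0 (-x) (by linarith)])
    (fun x hx => by simp [hχ1 (-x) (by linarith)]) (hχ2' b₂) (hχ2 b₁) hC.le
    (by simpa using him) (fun p hp => by rw [hrep p hp, neg_neg]; ring) hdec
  rw [h1, h2]
  constructor
  · field_simp
    simp
  · field_simp
    simp
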